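/- arXiv:1509.04273 — 14 statements merged into one kernel-verified Lean document; each statement's English description precedes it below -/
import Mathlib

section
/- If (K, I) and (K', I') are both split partitions of the same graph G, then |I \ I'| ≤ 1 and |I' \ I| ≤ 1. -/
variable {V : Type*}

/-- `(K, I)` is a split partition of `G`: every vertex is in `K` or `I`, the sets are
disjoint, `K` is a clique and `I` is an independent set. -/
def IsSplitPartition (G : SimpleGraph V) (K I : Set V) : Prop :=
  (∀ v, v ∈ K ∨ v ∈ I) ∧ Disjoint K I ∧
  (∀ u ∈ K, ∀ v ∈ K, u ≠ v → G.Adj u v) ∧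
  (∀ u ∈ I, ∀ v ∈ I, ¬ G.Adj u v)

/-- `G` is `H`-free: there is no induced-subgraph embedding of `H` into `G`,
i.e. no induced subgraph of `G` is isomorphic to `H`. -/
def HFree {W : Type*} (G : SimpleGraph V) (H : SimpleGraph W) : Prop :=
  IsEmpty (H ↪g G)

/-- The bull: vertices a,b,c,d,e = 0,1,2,3,4 with edges ab, bc, ca, ad, be. -/
def bull : SimpleGraph (Fin 5) :=
  SimpleGraph.fromRel (fun u v =>
    (u, v) ∈ ([(0,1),(1,2),(2,0),(0,3),(1,4)] : List (Fin 5 × Fin 5)))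

/-- The dart: vertices a,b,c,d,e = 0,1,2,3,4 with edges ab, bc, ca, ad, be, bd. -/
def dart : SimpleGraph (Fin 5) :=
  SimpleGraph.fromRel (fun u v =>
    (u, v) ∈ ([(0,1),(1,2),(2,0),(0,3),(1,4),(1,3)] : List (Fin 5 × Fin 5)))

/-- `F₁`: a `K₄` on vertices a,b,c,d = 0,1,2,3, a vertex e = 4 adjacent only to a,
and a vertex f = 5 adjacent only to d. -/
def F1 : SimpleGraph (Fin 6) :=
  SimpleGraph.fromRel (fun u v =>
    (u, v) ∈ ([(0,1),(0,2),(0,3),(1,2),(1,3),(2,3),(0,4),(3,5)] : List (Fin 6 × Fin 6)))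

/-- `F₂`: a `K₄` on vertices a,b,c,d = 0,1,2,3, a vertex e = 4 adjacent only to a,
and a vertex f = 5 adjacent only to c and d. -/
def F2 : SimpleGraph (Fin 6) :=
  SimpleGraph.fromRel (fun u v =>
    (u, v) ∈ ([(0,1),(0,2),(0,3),(1,2),(1,3),(2,3),(0,4),(2,5),(3,5)] : List (Fin 6 × Fin 6)))

/-- `F₃`: a `K₄` on vertices a,b,c,d = 0,1,2,3, a vertex z = 4 adjacent only to a and b,
and a vertex y = 5 adjacent only to b. -/
def F3 : SimpleGraph (Fin 6) :=
  SimpleGraph.fromRel (fun u v =>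
    (u, v) ∈ ([(0,1),(0,2),(0,3),(1,2),(1,3),(2,3),(0,4),(1,4),(1,5)] : List (Fin 6 × Fin 6)))

/-- `Q`: vertices j1,j2,j3,i1,i2,i3 = 0,1,2,3,4,5 with edges
j1j2, j1j3, j2j3, i1j1, i2j2, i3j2, i3j3. -/
def Qgraph : SimpleGraph (Fin 6) :=
  SimpleGraph.fromRel (fun u v =>
    (u, v) ∈ ([(0,1),(0,2),(1,2),(3,0),(4,1),(5,1),(5,2)] : List (Fin 6 × Fin 6)))

/-- `K_{1,3} + 2P₁`: a star with centre 0 and leaves 1,2,3, plus isolated vertices 4,5. -/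
def K13_2P1 : SimpleGraph (Fin 6) :=
  SimpleGraph.fromRel (fun u v =>
    (u, v) ∈ ([(0,1),(0,2),(0,3)] : List (Fin 6 × Fin 6)))

/-- A module of `G`: every vertex outside `M` is adjacent to all of `M` or to none of it. -/
def IsModule (G : SimpleGraph V) (M : Set V) : Prop :=
  ∀ v ∉ M, (∀ u ∈ M, G.Adj v u) ∨ (∀ u ∈ M, ¬ G.Adj v u)

/-- `G` is prime: every module of `G` is trivial (has at most one vertex,
or is the whole vertex set). -/
def IsPrime (G : SimpleGraph V) : Prop :=
  ∀ M : Set V, IsModule G M → M.Subsingleton ∨ M = Set.univ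

/-- The independent side of one split partition exceeds that of another by at most one vertex,
since the excess lies both in an independent set and in a clique. -/
theorem IsSplitPartition.encard_diff_le_one {G : SimpleGraph V} {K I K' I' : Set V}
    (h : IsSplitPartition G K I) (h' : IsSplitPartition G K' I') :
    (I \ I').encard ≤ 1 := by
  rw [Set.encard_le_one_iff]
  rintro a b ⟨ha, ha'⟩ ⟨hb, hb'⟩
  by_contra hab
  exact h.2.2.2 a ha b hb
    (h'.2.2.1 a ((h'.1 a).resolve_right ha') b ((h'.1 b).resolve_right hb') hab)

/-- If `(K, I)` and `(K', I')` are both split partitions of the same graph `G`,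
then `|I \ I'| ≤ 1` and `|I' \ I| ≤ 1`. -/
theorem split_partitions_indep_diff_small (G : SimpleGraph V) (K I K' I' : Set V)
    (h : IsSplitPartition G K I) (h' : IsSplitPartition G K' I') :
    (I \ I').encard ≤ 1 ∧ (I' \ I).encard ≤ 1 := by
  exact ⟨h.encard_diff_le_one h', h'.encard_diff_le_one h⟩
end

section
/- Let (K, I) and (K', I') be split partitions of a graph G with |I \ I'| = 1 and |I' \ I| = 1. Then the two split partitions are isomorphic, i.e., there is an automorphism f of G such that for every vertex u, u ∈ K if and only if f(u) ∈ K'. -/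
variable {V : Type*}

/-- Swapping two vertices with the same neighbours outside the pair is an automorphism. -/
def swapIso [DecidableEq V] (G : SimpleGraph V) (x y : V)
    (hxy : ∀ w, w ≠ x → w ≠ y → (G.Adj w x ↔ G.Adj w y)) : G ≃g G where
  toEquiv := Equiv.swap x y
  map_rel_iff' := by
    intro a b
    have hc := fun u v => G.adj_comm u v
    have hl := fun u => G.irrefl (v := u)
    simp only [Equiv.swap_apply_def]
    grind

/-- Let `(K, I)` and `(K', I')` be split partitions of a graph `G` with `|I \ I'| = 1` and
`|I' \ I| = 1`. Then the two split partitions are isomorphic: there is an automorphism `f`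
of `G` such that for every vertex `u`, `u ∈ K ↔ f u ∈ K'`. -/
theorem split_partitions_isomorphic (G : SimpleGraph V) (K I K' I' : Set V)
    (h : IsSplitPartition G K I) (h' : IsSplitPartition G K' I')
    (hI : (I \ I').encard = 1) (hI' : (I' \ I).encard = 1) :
    ∃ f : G ≃g G, ∀ u : V, u ∈ K ↔ f u ∈ K' := by
  classical
  obtain ⟨x, hx⟩ := Set.encard_eq_one.mp hI
  obtain ⟨y, hy⟩ := Set.encard_eq_one.mp hI'
  obtain ⟨hcover, hdisj, hclique, hindep⟩ := h
  obtain ⟨hcover', hdisj', hclique', hindep'⟩ := h'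
  have hK : ∀ v, v ∈ K ↔ v ∉ I := fun v =>
    ⟨fun hv => Set.disjoint_left.mp hdisj hv, (hcover v).resolve_right⟩
  have hK' : ∀ v, v ∈ K' ↔ v ∉ I' := fun v =>
    ⟨fun hv => Set.disjoint_left.mp hdisj' hv, (hcover' v).resolve_right⟩
  have hx' : ∀ v, v ∈ I ∧ v ∉ I' ↔ v = x := fun v => Set.ext_iff.mp hx v
  have hy' : ∀ v, v ∈ I' ∧ v ∉ I ↔ v = y := fun v => Set.ext_iff.mp hy v
  have hxI := (hx' x).mpr rfl
  have hyI := (hy' y).mpr rfl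
  have hsame : ∀ w, w ≠ x → w ≠ y → (w ∈ I ↔ w ∈ I') := by grind
  refine ⟨swapIso G x y fun w hwx hwy => ?_, fun u => ?_⟩
  · by_cases hw : w ∈ I
    · exact iff_of_false (hindep w hw x hxI.1)
        (hindep' w ((hsame w hwx hwy).mp hw) y hyI.1)
    · have hw' := mt (hsame w hwx hwy).mpr hw
      exact iff_of_true (hclique' w ((hK' w).mpr hw') x ((hK' x).mpr hxI.2) hwx)
        (hclique w ((hK w).mpr hw) y ((hK y).mpr hyI.2) hwy)
  · change u ∈ K ↔ Equiv.swap x y u ∈ K'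
    rw [hK, hK', Equiv.swap_apply_def]
    grind
end

section
/- Let G be a split graph with split partition (K, I), and suppose f is an induced-subgraph embedding of Q into G. Then f(j1), f(j2), f(j3) ∈ K and f(i1), f(i2), f(i3) ∈ I; in particular, every induced copy of Q in G has exactly three vertices in K (forming its triangle) and three vertices in I. -/
variable {V : Type*}

/-- Two vertices that are distinct and non-adjacent in `H` are not both mapped into the clique
part of a split partition by an embedding of `H`. -/
theorem IsSplitPartition.mem_or_mem_of_not_adj {W : Type*} {G : SimpleGraph V} {K I : Set V}
    (h : IsSplitPartition G K I) {H : SimpleGraph W} (f : H ↪g G) {a b : W}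
    (hne : a ≠ b) (hab : ¬ H.Adj a b) : f a ∈ I ∨ f b ∈ I := by
  by_contra! hI
  exact hab (f.map_adj_iff.1 (h.2.2.1 _ ((h.1 _).resolve_right hI.1) _
    ((h.1 _).resolve_right hI.2) (f.injective.ne hne)))

/-- Two vertices that are adjacent in `H` are not both mapped into the independent part of a
split partition by an embedding of `H`. -/
theorem IsSplitPartition.not_mem_and_mem_of_adj {W : Type*} {G : SimpleGraph V} {K I : Set V}
    (h : IsSplitPartition G K I) {H : SimpleGraph W} (f : H ↪g G) {a b : W}
    (hab : H.Adj a b) : ¬ (f a ∈ I ∧ f b ∈ I) :=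
  fun hI => h.2.2.2 _ hI.1 _ hI.2 (f.map_adj_iff.2 hab)

/-- Let `G` be a split graph with split partition `(K, I)` and let `f` be an
induced-subgraph embedding of `Q` into `G` (where `j1,j2,j3,i1,i2,i3 = 0,1,2,3,4,5`).
Then `f j1, f j2, f j3 ∈ K` and `f i1, f i2, f i3 ∈ I`; in particular, every induced copy
of `Q` in `G` has exactly three vertices in `K` (forming its triangle) and three in `I`. -/
theorem Q_copy_triangle_in_clique (G : SimpleGraph V) (K I : Set V)
    (h : IsSplitPartition G K I) (f : Qgraph ↪g G) :
    f 0 ∈ K ∧ f 1 ∈ K ∧ f 2 ∈ K ∧ f 3 ∈ I ∧ f 4 ∈ I ∧ f 5 ∈ I := by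
  have not_both {a b : Fin 6} (hab : Qgraph.Adj a b) : ¬ (f a ∈ I ∧ f b ∈ I) :=
    h.not_mem_and_mem_of_adj f hab
  have n13 : f 1 ∈ I ∨ f 3 ∈ I := h.mem_or_mem_of_not_adj f (by decide) (by simp [Qgraph])
  have n04 : f 0 ∈ I ∨ f 4 ∈ I := h.mem_or_mem_of_not_adj f (by decide) (by simp [Qgraph])
  have n05 : f 0 ∈ I ∨ f 5 ∈ I := h.mem_or_mem_of_not_adj f (by decide) (by simp [Qgraph])
  have h0 : f 0 ∉ I := fun h0 => n13.elim
    (fun h1 => not_both (by simp [Qgraph]) ⟨h0, h1⟩)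
    (fun h3 => not_both (by simp [Qgraph]) ⟨h0, h3⟩)
  have h1 : f 1 ∉ I := fun h1 => n04.elim h0 fun h4 => not_both (by simp [Qgraph]) ⟨h1, h4⟩
  have h2 : f 2 ∉ I := fun h2 => n05.elim h0 fun h5 => not_both (by simp [Qgraph]) ⟨h2, h5⟩
  exact ⟨(h.1 _).resolve_right h0, (h.1 _).resolve_right h1, (h.1 _).resolve_right h2,
    n13.resolve_left h1, n04.resolve_left h0, n05.resolve_left h0⟩
end

section
/- Let G be a split graph with split partition (K, I). If G contains an induced copy of Q, then G contains an induced copy of the bull having exactly three of its vertices in K (its triangle) and two of its vertices in I. -/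
variable {V : Type*}

/-- The bull is obtained from `Q` by deleting the vertex i3. -/
def bullEmbeddingQ : bull ↪g Qgraph where
  toEmbedding := Fin.castSuccEmb
  map_rel_iff' {u v} := by
    revert u v
    simp only [bull, Qgraph, SimpleGraph.fromRel_adj, Fin.coe_castSuccEmb]
    decide

namespace IsSplitPartition

variable {G : SimpleGraph V} {K I : Set V}

lemma mem_left_of_adj (h : IsSplitPartition G K I) {u v : V} (hu : u ∈ I) (huv : G.Adj u v) :
    v ∈ K :=
  (h.1 v).resolve_right fun hv => h.2.2.2 u hu v hv huv

lemma mem_right_of_not_adj (h : IsSplitPartition G K I) {u v : V} (hu : u ∈ K) (hne : u ≠ v)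
    (huv : ¬ G.Adj u v) : v ∈ I :=
  (h.1 v).resolve_left fun hv => huv (h.2.2.1 u hu v hv hne)

/-- A vertex adjacent to neither end of an edge lies in the independent set. -/
lemma mem_right_of_adj_of_not_adj (h : IsSplitPartition G K I) {u v w : V} (hvw : G.Adj v w)
    (huv : ¬ G.Adj u v) (huw : ¬ G.Adj u w) : u ∈ I := by
  refine (h.1 u).resolve_left fun hu => ?_
  have hne : u ≠ v := by rintro rfl; exact huw hvw
  have hne' : u ≠ w := by rintro rfl; exact huv hvw.symm
  exact h.2.2.2 v (h.mem_right_of_not_adj hu hne huv) w (h.mem_right_of_not_adj hu hne' huw) hvw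

end IsSplitPartition

/-- Let `G` be a split graph with split partition `(K, I)`. If `G` contains an induced copy
of `Q`, then `G` contains an induced copy of the bull having exactly three of its vertices
in `K` (its triangle, the vertices a,b,c = 0,1,2) and two of its vertices in `I`. -/
theorem Q_gives_special_bull (G : SimpleGraph V) (K I : Set V)
    (h : IsSplitPartition G K I) (hQ : Nonempty (Qgraph ↪g G)) :
    ∃ f : bull ↪g G, f 0 ∈ K ∧ f 1 ∈ K ∧ f 2 ∈ K ∧ f 3 ∈ I ∧ f 4 ∈ I := by
  obtain ⟨g⟩ := hQ
  have adj {u v : Fin 6} (huv : Qgraph.Adj u v) : G.Adj (g u) (g v) := g.map_adj_iff.2 huv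
  have nadj {u v : Fin 6} (huv : ¬ Qgraph.Adj u v) : ¬ G.Adj (g u) (g v) :=
    fun hg => huv (g.map_adj_iff.1 hg)
  have i1 : g 3 ∈ I := h.mem_right_of_adj_of_not_adj
    (adj (u := 1) (v := 2) (by simp [Qgraph])) (nadj (by simp [Qgraph])) (nadj (by simp [Qgraph]))
  have i2 : g 4 ∈ I := h.mem_right_of_adj_of_not_adj
    (adj (u := 0) (v := 2) (by simp [Qgraph])) (nadj (by simp [Qgraph])) (nadj (by simp [Qgraph]))
  have i3 : g 5 ∈ I := h.mem_right_of_adj_of_not_adj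
    (adj (u := 0) (v := 3) (by simp [Qgraph])) (nadj (by simp [Qgraph])) (nadj (by simp [Qgraph]))
  have j1 : g 0 ∈ K := h.mem_left_of_adj i1 (adj (by simp [Qgraph]))
  have j2 : g 1 ∈ K := h.mem_left_of_adj i2 (adj (by simp [Qgraph]))
  have j3 : g 2 ∈ K := h.mem_left_of_adj i3 (adj (by simp [Qgraph]))
  exact ⟨g.comp bullEmbeddingQ, j1, j2, j3, i1, i2⟩
end

section
/- Let G be a split graph with split partition (K, I). If G contains an induced copy of Q, then G contains an induced copy of the dart having exactly three of its vertices in K and two of its vertices in I. -/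
variable {V : Type*}

/-- In a split graph, a vertex with two distinct non-adjacent neighbours belongs to the clique. -/
theorem IsSplitPartition.mem_clique {G : SimpleGraph V} {K I : Set V}
    (h : IsSplitPartition G K I) {u v w : V} (huv : G.Adj u v) (huw : G.Adj u w)
    (hne : v ≠ w) (hvw : ¬ G.Adj v w) : u ∈ K := by
  obtain ⟨hcover, -, hK, hI⟩ := h
  refine (hcover u).resolve_right fun hu => hvw (hK v ?_ w ?_ hne)
  · exact (hcover v).resolve_right fun hv => hI u hu v hv huv
  · exact (hcover w).resolve_right fun hw => hI u hu w hw huw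

/-- In a split graph, a vertex with a distinct non-neighbour in the clique belongs to the
independent set. -/
theorem IsSplitPartition.mem_indep {G : SimpleGraph V} {K I : Set V}
    (h : IsSplitPartition G K I) {u v : V} (hv : v ∈ K) (hne : u ≠ v)
    (huv : ¬ G.Adj u v) : u ∈ I :=
  (h.1 u).resolve_left fun hu => huv (h.2.2.1 u hu v hv hne)

/-- The copy of the dart in `Q` obtained by deleting `i1`. -/
def dartEmbeddingQ : dart ↪g Qgraph where
  toFun := ![2, 1, 0, 5, 4]
  inj' := by decide
  map_rel_iff' := by
    simp only [dart, Qgraph, SimpleGraph.fromRel_adj]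
    decide

/-- Let `G` be a split graph with split partition `(K, I)`. If `G` contains an induced copy
of `Q`, then `G` contains an induced copy of the dart having exactly three of its vertices
in `K` and two of its vertices in `I`. -/
theorem Q_gives_special_dart (G : SimpleGraph V) (K I : Set V)
    (h : IsSplitPartition G K I) (hQ : Nonempty (Qgraph ↪g G)) :
    ∃ (f : dart ↪g G) (S : Finset (Fin 5)), S.card = 3 ∧
      (∀ v ∈ S, f v ∈ K) ∧ (∀ v ∉ S, f v ∈ I) := by
  obtain ⟨g⟩ := hQ
  have hclique (u v w : Fin 6) (huv : Qgraph.Adj u v) (huw : Qgraph.Adj u w) (hne : v ≠ w)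
      (hvw : ¬ Qgraph.Adj v w) : g u ∈ K :=
    h.mem_clique (g.map_adj_iff.2 huv) (g.map_adj_iff.2 huw) (g.injective.ne hne)
      (mt g.map_adj_iff.1 hvw)
  have hindep (u v : Fin 6) (hv : g v ∈ K) (hne : u ≠ v) (huv : ¬ Qgraph.Adj u v) : g u ∈ I :=
    h.mem_indep hv (g.injective.ne hne) (mt g.map_adj_iff.1 huv)
  have h0 : g 0 ∈ K := by apply hclique 0 1 3 <;> simp [Qgraph]
  have h1 : g 1 ∈ K := by apply hclique 1 0 4 <;> simp [Qgraph]
  have h2 : g 2 ∈ K := by apply hclique 2 0 5 <;> simp [Qgraph]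
  have h4 : g 4 ∈ I := by apply hindep 4 0 h0 <;> simp [Qgraph]
  have h5 : g 5 ∈ I := by apply hindep 5 0 h0 <;> simp [Qgraph]
  refine ⟨g.comp dartEmbeddingQ, {0, 1, 2}, rfl, fun v hv => ?_, fun v hv => ?_⟩
  · fin_cases v
    exacts [h2, h1, h0, absurd hv (by decide), absurd hv (by decide)]
  · fin_cases v
    exacts [absurd hv (by decide), absurd hv (by decide), absurd hv (by decide), h5, h4]
end

section
/- Let G be an F_1-free split graph with split partition (K, I). If two vertices s, t ∈ I have two distinct common non-neighbours in K, then N(s) ⊆ N(t) or N(t) ⊆ N(s). -/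
variable {V : Type*}

/-- Let `G` be an `F₁`-free split graph with split partition `(K, I)`. If two vertices
`s, t ∈ I` have two distinct common non-neighbours in `K`, then `N(s) ⊆ N(t)` or
`N(t) ⊆ N(s)`. -/
theorem F1_free_nested_neighbourhoods (G : SimpleGraph V) (K I : Set V)
    (h : IsSplitPartition G K I) (hfree : HFree G F1)
    (s t : V) (hs : s ∈ I) (ht : t ∈ I) (u u' : V) (hu : u ∈ K) (hu' : u' ∈ K)
    (huu' : u ≠ u') (hsu : ¬ G.Adj s u) (htu : ¬ G.Adj t u)
    (hsu' : ¬ G.Adj s u') (htu' : ¬ G.Adj t u') :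
    G.neighborSet s ⊆ G.neighborSet t ∨ G.neighborSet t ⊆ G.neighborSet s := by
  obtain ⟨hcover, hdisj, hK, hI⟩ := h
  by_contra hnot
  obtain ⟨hst, hts⟩ := not_or.mp hnot
  obtain ⟨a, hsa, hta⟩ := Set.not_subset.mp hst
  obtain ⟨d, htd, hsd⟩ := Set.not_subset.mp hts
  rw [SimpleGraph.mem_neighborSet] at hsa hta htd hsd
  have haK : a ∈ K := (hcover a).resolve_right fun ha => hI s hs a ha hsa
  have hdK : d ∈ K := (hcover d).resolve_right fun hd => hI t ht d hd htd
  have hne {x y : V} (hx : x ∈ K) (hy : y ∈ I) : x ≠ y := hdisj.ne_of_mem hx hy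
  have hau : a ≠ u := fun e => hsu (e ▸ hsa)
  have hau' : a ≠ u' := fun e => hsu' (e ▸ hsa)
  have hdu : d ≠ u := fun e => htu (e ▸ htd)
  have hdu' : d ≠ u' := fun e => htu' (e ▸ htd)
  have had : a ≠ d := fun e => hsd (e ▸ hsa)
  have hst' : s ≠ t := fun e => hta (e ▸ hsa)
  have hinj : Function.Injective ![a, u, u', d, s, t] := by
    have := hne haK hs
    have := hne haK ht
    have := hne hu hs
    have := hne hu ht
    have := hne hu' hs
    have := hne hu' ht
    have := hne hdK hs
    have := hne hdK ht
    intro i j hij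
    fin_cases i <;> fin_cases j <;> simp at hij ⊢ <;> grind
  refine hfree.false ⟨⟨_, hinj⟩, fun {i j} => ?_⟩
  have := hK a haK u hu hau
  have := hK a haK u' hu' hau'
  have := hK a haK d hdK had
  have := hK u hu u' hu' huu'
  have := hK d hdK u hu hdu
  have := hK d hdK u' hu' hdu'
  have := hI s hs t ht
  fin_cases i <;> fin_cases j <;> simp [F1] <;> grind [G.adj_comm]
end

section
/- Let G be an F_1-free split graph with split partition (K, I). Suppose G contains an induced copy of the bull whose triangle T is contained in K and whose other two vertices lie in I. Then every vertex of I has a non-neighbour in T. -/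
variable {V : Type*}

/-- Let `G` be an `F₁`-free split graph with split partition `(K, I)`. Suppose `G` contains
an induced copy of the bull whose triangle `T = {a,b,c} = {0,1,2}` is contained in `K` and
whose other two vertices lie in `I`. Then every vertex of `I` has a non-neighbour in `T`. -/
theorem F1_free_special_bull_nonneighbour (G : SimpleGraph V) (K I : Set V)
    (h : IsSplitPartition G K I) (hfree : HFree G F1)
    (f : bull ↪g G) (h0 : f 0 ∈ K) (h1 : f 1 ∈ K) (h2 : f 2 ∈ K)
    (h3 : f 3 ∈ I) (h4 : f 4 ∈ I) :
    ∀ x ∈ I, ∃ v ∈ ({f 0, f 1, f 2} : Set V), ¬ G.Adj x v := by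
  obtain ⟨-, -, -, hI⟩ := h
  intro x hx
  by_contra! hT
  have hx0 : G.Adj x (f 0) := hT _ (by simp)
  have hx1 : G.Adj x (f 1) := hT _ (by simp)
  have hx2 : G.Adj x (f 2) := hT _ (by simp)
  have hx3 : ¬ G.Adj x (f 3) := hI _ hx _ h3
  have hx4 : ¬ G.Adj x (f 4) := hI _ hx _ h4
  have hbull (i j : Fin 5) : G.Adj (f i) (f j) ↔ bull.Adj i j := f.map_adj_iff
  have hne : x ∉ Set.range f := by
    rintro ⟨i, rfl⟩
    simp only [hbull] at hx0 hx1 hx2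
    fin_cases i <;> simp [bull] at hx0 hx1 hx2
  have hinj : Function.Injective ((Fin.cons x f : Fin 6 → V) ∘ ![1, 3, 0, 2, 4, 5]) :=
    (Fin.cons_injective_iff.2 ⟨hne, f.injective⟩).comp (by decide)
  have hcons : (Fin.cons x f : Fin 6 → V) ∘ ![1, 3, 0, 2, 4, 5] =
      ![f 0, f 2, x, f 1, f 3, f 4] := by
    ext i
    fin_cases i <;> rfl
  rw [hcons] at hinj
  refine hfree.false ⟨⟨_, hinj⟩, fun {i j} => ?_⟩
  rw [Function.Embedding.coeFn_mk]
  fin_cases i <;> fin_cases j <;> simp [F1] <;>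
    first
    | assumption
    | exact hx0.symm
    | exact hx1.symm
    | exact hx2.symm
    | exact mt G.adj_symm hx3
    | exact mt G.adj_symm hx4
    | simp [bull]
end

section
/- No prime F_1-free split graph with split partition (K, I) contains 18 pairwise vertex-disjoint induced copies of the bull each having exactly three of its vertices in K and two of its vertices in I. -/
variable {V : Type*}

/-- Consider a family of sets in which incomparable members meet in at most one point. It does not
contain 18 disjoint pairs of sets `A i true`, `A i false`, meeting in a point `z i` and otherwise
pointed by `t i true`, `t i false`, such that any member avoiding `z i` contains one of the two
sets of the `i`-th pair apart from `z i`. -/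
theorem no_eighteen_crossing_pairs (A : Fin 18 → Bool → Set V) (t : Fin 18 → Bool → V)
    (z : Fin 18 → V)
    (z_mem : ∀ i b, z i ∈ A i b) (t_mem : ∀ i b, t i b ∈ A i b)
    (t_notMem : ∀ i b, t i b ∉ A i (!b))
    (z_inj : ∀ i j, z i = z j → i = j) (t_inj : ∀ i j b c, t i b = t j c → i = j)
    (z_ne_t : ∀ i j b, t j b ≠ z i)
    (A_inj : ∀ i j b c, A i b = A j c → i = j)
    (cross : ∀ i b j c, A i b ⊆ A j c ∨ A j c ⊆ A i b ∨ (A i b ∩ A j c).Subsingleton)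
    (avoid : ∀ i j c, z i ∉ A j c → ∃ b, A i b \ {z i} ⊆ A j c) : False := by
  classical
  have avoid_cases : ∀ i j c, z i ∉ A j c →
      ∃ b, A i b \ {z i} = A j c ∨ (A i b = {z i, t i b} ∧ t i b ∈ A j c) := by
    intro i j c hz
    obtain ⟨b, hb⟩ := avoid i j c hz
    have ht : t i b ∈ A j c := hb ⟨t_mem i b, z_ne_t i i b⟩
    refine ⟨b, ?_⟩
    rcases cross i b j c with h | h | h
    · exact absurd (h (z_mem i b)) hz
    · exact Or.inl (hb.antisymm fun x hx => ⟨h hx, fun hxz => hz (hxz ▸ hx)⟩)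
    · refine Or.inr ⟨Set.Subset.antisymm (fun x hx => ?_) ?_, ht⟩
      · by_cases hxz : x = z i
        · exact Or.inl hxz
        · exact Or.inr (h ⟨hx, hb ⟨hx, hxz⟩⟩ ⟨t_mem i b, ht⟩)
      · rintro x (rfl | rfl)
        exacts [z_mem i b, t_mem i b]
  have exists_avoiding : ∀ i j, i ≠ j → ∃ c, z i ∉ A j c := by
    intro i j hij
    by_contra! hc
    rcases cross j true j false with h | h | h
    · exact t_notMem j true (h (t_mem j true))
    · exact t_notMem j false (h (t_mem j false))
    · exact hij (z_inj i j (h ⟨hc true, hc false⟩ ⟨z_mem j true, z_mem j false⟩))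
  let D : Fin 18 → Bool → Finset (Fin 18) := fun i b =>
    Finset.univ.filter fun j => ∃ c, A i b \ {z i} = A j c
  have card_D : ∀ i b, (D i b).card ≤ 1 := by
    intro i b
    refine Finset.card_le_one.2 fun j hj k hk => ?_
    obtain ⟨c, hc⟩ := (Finset.mem_filter.1 hj).2
    obtain ⟨d, hd⟩ := (Finset.mem_filter.1 hk).2
    exact A_inj j k c d (hc.symm.trans hd)
  let E : Fin 18 → Finset (Fin 18) := fun i => insert i (D i true ∪ D i false)
  have card_E : ∀ i, (E i).card ≤ 3 := by
    intro i
    have h₁ := Finset.card_insert_le i (D i true ∪ D i false)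
    have h₂ := Finset.card_union_le (D i true) (D i false)
    have h₃ := card_D i true
    have h₄ := card_D i false
    change (insert i (D i true ∪ D i false)).card ≤ 3
    omega
  have hit : ∀ i, ∀ j ∉ E i,
      i ≠ j ∧ ∃ c a, z i ∉ A j c ∧ A i a = {z i, t i a} ∧ t i a ∈ A j c := by
    intro i j hj
    have hj' : j ≠ i ∧ j ∉ D i true ∧ j ∉ D i false := by
      simpa [E, Finset.mem_insert, Finset.mem_union] using hj
    refine ⟨hj'.1.symm, ?_⟩
    obtain ⟨c, hc⟩ := exists_avoiding i j hj'.1.symm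
    obtain ⟨a, ha | ⟨h₁, h₂⟩⟩ := avoid_cases i j c hc
    · have hD : j ∈ D i a := Finset.mem_filter.2 ⟨Finset.mem_univ _, c, ha⟩
      cases a
      exacts [absurd hD hj'.2.2, absurd hD hj'.2.1]
    · exact ⟨c, a, hc, h₁, h₂⟩
  have exists_pair : ∀ i, ∃ b, A i b = {z i, t i b} := by
    intro i
    obtain ⟨j, hj⟩ : ∃ j, j ∉ E i := by
      by_contra! hall
      have h₁ := Finset.card_le_card fun j (_ : j ∈ (Finset.univ : Finset (Fin 18))) => hall j
      have h₂ := card_E i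
      simp only [Finset.card_univ, Fintype.card_fin] at h₁
      omega
    obtain ⟨-, c, a, -, ha, -⟩ := hit i j hj
    exact ⟨a, ha⟩
  choose b hb using exists_pair
  have notMem_pair : ∀ i j a c, i ≠ j → A j c = {z j, t j c} → t i a ∉ A j c := by
    intro i j a c hij hA ht
    rw [hA] at ht
    rcases ht with ht | ht
    · exact z_ne_t _ _ _ ht
    · exact hij (t_inj _ _ _ _ ht)
  have hit_large : ∀ i, ∀ j ∉ E i, i ≠ j ∧
      ∃ a, z i ∉ A j (!b j) ∧ A i a = {z i, t i a} ∧ t i a ∈ A j (!b j) := by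
    intro i j hj
    obtain ⟨hij, c, a, hz, hA, ht⟩ := hit i j hj
    have hc : c = !b j := by
      by_contra hc
      have hcb : c = b j := by
        revert hc
        cases c <;> cases b j <;> simp
      exact notMem_pair i j a c hij (by rw [hcb]; exact hb j) ht
    subst hc
    exact ⟨hij, a, hz, hA, ht⟩
  let T : Finset (Fin 18) := Finset.univ.filter fun i => A i (!b i) ≠ {z i, t i (!b i)}
  have card_T : 15 ≤ T.card := by
    have hsub : Tᶜ ⊆ E 0 := by
      intro i hi
      by_contra hiE
      have hA : A i (!b i) = {z i, t i (!b i)} := by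
        simpa [T] using hi
      obtain ⟨hne, a, -, -, ht⟩ := hit_large 0 i hiE
      exact notMem_pair 0 i a _ hne hA ht
    have h₁ := Finset.card_le_card hsub
    have h₂ := card_E 0
    rw [Finset.card_compl, Fintype.card_fin] at h₁
    omega
  have hit_T : ∀ i ∈ T, ∀ j ∉ E i, t i (b i) ∈ A j (!b j) := by
    intro i hi j hj
    obtain ⟨-, a, -, hA, ht⟩ := hit_large i j hj
    have ha : a = b i := by
      by_contra ha
      have hab : a = !b i := by
        revert ha
        cases a <;> cases b i <;> simp
      exact (Finset.mem_filter.1 hi).2 (hab ▸ hA)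
    exact ha ▸ ht
  obtain ⟨i, hi, k, hk, hik⟩ := Finset.one_lt_card.1 (show 1 < T.card by omega)
  have card_S : 12 ≤ (E i ∪ E k)ᶜ.card := by
    have h₁ := Finset.card_union_le (E i) (E k)
    have h₂ := card_E i
    have h₃ := card_E k
    rw [Finset.card_compl, Fintype.card_fin]
    omega
  obtain ⟨m, hm⟩ := Finset.exists_minimalFor (fun j => A j (!b j)) (E i ∪ E k)ᶜ
    (Finset.card_pos.1 (by omega))
  have hsub : (E i ∪ E k)ᶜ ⊆ E m := by
    intro j hj
    by_contra hjE
    obtain ⟨-, -, hz, -⟩ := hit_large m j hjE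
    have hmS := hm.1
    simp only [Finset.mem_compl, Finset.mem_union, not_or] at hj hmS
    rcases cross m (!b m) j (!b j) with h | h | h
    · exact hz (h (z_mem _ _))
    · exact hz (hm.2 (by simpa using hj) h (z_mem _ _))
    · exact hik (t_inj _ _ _ _ (h ⟨hit_T i hi m hmS.1, hit_T i hi j hj.1⟩
        ⟨hit_T k hk m hmS.2, hit_T k hk j hj.2⟩))
  have h₁ := Finset.card_le_card hsub
  have h₂ := card_E m
  omega

theorem eq_of_card_eq_three_of_isClique_bull (S : Finset (Fin 5)) (hS : S.card = 3)
    (hc : ∀ u ∈ S, ∀ v ∈ S, u ≠ v → bull.Adj u v) : S = {0, 1, 2} := by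
  simp only [bull, SimpleGraph.fromRel_adj, List.mem_cons, Prod.mk.injEq, List.not_mem_nil, or_false] at hc
  revert S
  decide

set_option synthInstance.maxSize 1000 in
set_option synthInstance.maxHeartbeats 200000 in
/-- In an `F₁`-free graph there is no `K₄` on `a, b, c, d` with nonadjacent vertices `e` and `f`
whose only neighbours in it are `a` and `d`, respectively. -/
theorem HFree.not_F1 {G : SimpleGraph V} (hfree : HFree G F1) {a b c d e f : V}
    (hab : G.Adj a b) (hac : G.Adj a c) (had : G.Adj a d) (hbc : G.Adj b c) (hbd : G.Adj b d)
    (hcd : G.Adj c d) (hae : G.Adj a e) (hdf : G.Adj d f)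
    (hbe : ¬ G.Adj b e) (hce : ¬ G.Adj c e) (hde : ¬ G.Adj d e)
    (haf : ¬ G.Adj a f) (hbf : ¬ G.Adj b f) (hcf : ¬ G.Adj c f) (hef : ¬ G.Adj e f) : False := by
  have adj : ∀ u v : Fin 6, G.Adj (![a, b, c, d, e, f] u) (![a, b, c, d, e, f] v) ↔
      F1.Adj u v := by
    intro u v
    fin_cases u <;> fin_cases v <;>
      simp [F1, SimpleGraph.fromRel_adj, hab, hac, had, hbc, hbd, hcd, hae, hdf, hbe, hce, hde,
        haf, hbf, hcf, hef, hab.symm, hac.symm, had.symm, hbc.symm, hbd.symm, hcd.symm, hae.symm,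
        hdf.symm, mt G.adj_symm hbe, mt G.adj_symm hce, mt G.adj_symm hde, mt G.adj_symm haf,
        mt G.adj_symm hbf, mt G.adj_symm hcf, mt G.adj_symm hef]
  have twin_free : ∀ u v : Fin 6, (∀ w, F1.Adj u w ↔ F1.Adj v w) → u = v := by
    simp only [F1, SimpleGraph.fromRel_adj, List.mem_cons, Prod.mk.injEq, List.not_mem_nil, or_false]
    decide
  refine hfree.false ⟨⟨![a, b, c, d, e, f], fun u v huv => ?_⟩, adj _ _⟩
  exact twin_free u v fun w => by rw [← adj u w, ← adj v w, huv]

/-- The vertices of `K` not adjacent to `v`. -/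
def nonNeighborsIn (G : SimpleGraph V) (K : Set V) (v : V) : Set V :=
  {u ∈ K | ¬ G.Adj u v}

section SplitPartition

variable {G : SimpleGraph V} {K I : Set V}

theorem nonNeighborsIn_cross (h : IsSplitPartition G K I) (hfree : HFree G F1) {x y : V}
    (hx : x ∈ I) (hy : y ∈ I) :
    nonNeighborsIn G K x ⊆ nonNeighborsIn G K y ∨ nonNeighborsIn G K y ⊆ nonNeighborsIn G K x ∨
      (nonNeighborsIn G K x ∩ nonNeighborsIn G K y).Subsingleton := by
  obtain ⟨-, -, hK, hI⟩ := h
  by_contra! hcon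
  obtain ⟨hxy, hyx, hss⟩ := hcon
  obtain ⟨d, ⟨hdK, hdx⟩, hdy⟩ := Set.not_subset.1 hxy
  obtain ⟨a, ⟨haK, hay⟩, hax⟩ := Set.not_subset.1 hyx
  obtain ⟨b, ⟨⟨hbK, hbx⟩, -, hby⟩, c, ⟨⟨hcK, hcx⟩, -, hcy⟩, hbc⟩ := hss
  replace hdy : G.Adj d y := not_not.1 fun h => hdy ⟨hdK, h⟩
  replace hax : G.Adj a x := not_not.1 fun h => hax ⟨haK, h⟩
  have ne : ∀ {u v w : V}, G.Adj u w → ¬ G.Adj v w → u ≠ v := fun h₁ h₂ e => h₂ (e ▸ h₁)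
  exact hfree.not_F1 (hK a haK b hbK (ne hax hbx)) (hK a haK c hcK (ne hax hcx))
    (hK a haK d hdK (ne hax hdx)) (hK b hbK c hcK hbc) (hK b hbK d hdK (ne hdy hby).symm)
    (hK c hcK d hdK (ne hdy hcy).symm) hax hdy hbx hcx hdx hay hby hcy (hI x hx y hy)

theorem nonNeighborsIn_avoid (h : IsSplitPartition G K I) (hfree : HFree G F1) {x y w z : V}
    (hx : x ∈ I) (hy : y ∈ I) (hw : w ∈ I) (hzx : z ∈ nonNeighborsIn G K x)
    (hzy : z ∈ nonNeighborsIn G K y) (hzw : z ∉ nonNeighborsIn G K w)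
    (hxy : ¬ nonNeighborsIn G K x ⊆ nonNeighborsIn G K y)
    (hyx : ¬ nonNeighborsIn G K y ⊆ nonNeighborsIn G K x) :
    nonNeighborsIn G K x \ {z} ⊆ nonNeighborsIn G K w ∨
      nonNeighborsIn G K y \ {z} ⊆ nonNeighborsIn G K w := by
  have hss := ((nonNeighborsIn_cross h hfree hx hy).resolve_left hxy).resolve_left hyx
  obtain ⟨-, -, hK, hI⟩ := h
  by_contra! hcon
  obtain ⟨d, ⟨⟨hdK, hdx⟩, hdz⟩, hdw⟩ := Set.not_subset.1 hcon.1
  obtain ⟨a, ⟨⟨haK, hay⟩, haz⟩, haw⟩ := Set.not_subset.1 hcon.2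
  have hdy : G.Adj d y := not_not.1 fun h => hdz (hss ⟨⟨hdK, hdx⟩, hdK, h⟩ ⟨hzx, hzy⟩)
  have hax : G.Adj a x := not_not.1 fun h => haz (hss ⟨⟨haK, h⟩, haK, hay⟩ ⟨hzx, hzy⟩)
  replace hdw : G.Adj d w := not_not.1 fun h => hdw ⟨hdK, h⟩
  replace haw : G.Adj a w := not_not.1 fun h => haw ⟨haK, h⟩
  replace hzw : G.Adj z w := not_not.1 fun h => hzw ⟨hzx.1, h⟩
  exact hfree.not_F1 haw (hK a haK z hzx.1 haz) (hK a haK d hdK fun e => hdx (e ▸ hax)) hzw.symm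
    hdw.symm (hK z hzx.1 d hdK (Ne.symm hdz)) hax hdy (hI w hw x hx) hzx.2 hdx hay (hI w hw y hy)
    hzy.2 (hI x hx y hy)

theorem nonNeighborsIn_injOn (h : IsSplitPartition G K I) (hprime : IsPrime G) {v : V}
    (hv : v ∈ K) : Set.InjOn (nonNeighborsIn G K) I := by
  obtain ⟨hKI, hdisj, -, hI⟩ := h
  intro x hx y hy hxy
  have hmod : IsModule G {x, y} := by
    intro u _
    have hiff : G.Adj u x ↔ G.Adj u y := by
      rcases hKI u with hu | hu
      · have := Set.ext_iff.1 hxy u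
        simp only [nonNeighborsIn, Set.mem_ofPred_eq, hu, true_and] at this
        exact not_iff_not.1 this
      · exact iff_of_false (hI u hu x hx) (hI u hu y hy)
    by_cases hux : G.Adj u x
    · left
      rintro w (rfl | rfl)
      exacts [hux, hiff.1 hux]
    · right
      rintro w (rfl | rfl)
      exacts [hux, fun h => hux (hiff.2 h)]
  rcases hprime _ hmod with hs | hs
  · exact hs (Or.inl rfl) (Or.inr rfl)
  · rcases hs.symm ▸ Set.mem_univ v with hvx | hvy
    · exact absurd hx (hdisj.notMem_of_mem_left (hvx ▸ hv))
    · exact absurd hy (hdisj.notMem_of_mem_left (hvy ▸ hv))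

end SplitPartition

/-- No prime `F₁`-free split graph with split partition `(K, I)` contains 18 pairwise
vertex-disjoint induced copies of the bull, each having exactly three of its vertices in
`K` and two of its vertices in `I`. -/
theorem prime_F1_free_no_18_special_bulls (G : SimpleGraph V) (K I : Set V)
    (h : IsSplitPartition G K I) (hprime : IsPrime G) (hfree : HFree G F1) :
    ¬ ∃ (f : Fin 18 → (bull ↪g G)) (S : Fin 18 → Finset (Fin 5)),
        (∀ i j, i ≠ j → Disjoint (Set.range (f i)) (Set.range (f j))) ∧
        (∀ i, (S i).card = 3) ∧
        (∀ i, ∀ v ∈ S i, (f i) v ∈ K) ∧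
        (∀ i, ∀ v ∉ S i, (f i) v ∈ I) := by
  rintro ⟨f, S, hdisj, hcard, hSK, hSI⟩
  have hS : ∀ i, S i = {0, 1, 2} := fun i =>
    eq_of_card_eq_three_of_isClique_bull (S i) (hcard i) fun u hu v hv huv =>
      (f i).map_adj_iff.1 (h.2.2.1 _ (hSK i u hu) _ (hSK i v hv) fun e => huv ((f i).injective e))
  simp only [hS] at hSK hSI
  have idx : ∀ i j u v, f i u = f j v → i = j := by
    intro i j u v huv
    by_contra hij
    exact Set.disjoint_left.1 (hdisj i j hij) ⟨u, rfl⟩ ⟨v, huv.symm⟩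
  have mem : ∀ i u v, u ∈ ({0, 1, 2} : Finset (Fin 5)) → ¬ bull.Adj u v →
      f i u ∈ nonNeighborsIn G K (f i v) :=
    fun i u v hu huv => ⟨hSK i u hu, fun e => huv ((f i).map_adj_iff.1 e)⟩
  have notMem : ∀ i u v, bull.Adj u v → f i u ∉ nonNeighborsIn G K (f i v) :=
    fun i u v huv hu => hu.2 ((f i).map_adj_iff.2 huv)
  let x : Bool → Fin 5 := fun b => if b then 3 else 4
  let p : Bool → Fin 5 := fun b => if b then 1 else 0
  have hxI : ∀ i b, f i (x b) ∈ I := fun i b => hSI i _ (by cases b <;> decide)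
  have htm : ∀ i b, f i (p b) ∈ nonNeighborsIn G K (f i (x b)) := fun i b =>
    mem i _ _ (by cases b <;> decide) (by cases b <;> simp [x, p, bull])
  have htn : ∀ i b, f i (p b) ∉ nonNeighborsIn G K (f i (x !b)) := fun i b =>
    notMem i _ _ (by cases b <;> simp [x, p, bull])
  have hzm : ∀ i b, f i 2 ∈ nonNeighborsIn G K (f i (x b)) := fun i b =>
    mem i _ _ (by decide) (by cases b <;> simp [x, bull])
  refine no_eighteen_crossing_pairs (fun i b => nonNeighborsIn G K (f i (x b)))
    (fun i b => f i (p b)) (fun i => f i 2) hzm htm htn (fun i j => idx i j 2 2)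
    (fun i j b c => idx i j _ _) ?_ ?_
    (fun i b j c => nonNeighborsIn_cross h hfree (hxI i b) (hxI j c)) ?_
  · intro i j b e
    obtain rfl := idx _ _ _ _ e
    have := (f j).injective e
    revert this
    cases b <;> simp [p]
  · intro i j b c e
    exact idx _ _ _ _ (nonNeighborsIn_injOn h hprime (hSK 0 0 (by decide)) (hxI i b) (hxI j c) e)
  · intro i j c hz
    rcases nonNeighborsIn_avoid h hfree (hxI i true) (hxI i false) (hxI j c) (hzm i true)
      (hzm i false) hz (fun e => htn i true (e (htm i true)))
      (fun e => htn i false (e (htm i false))) with e | e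
    exacts [⟨true, e⟩, ⟨false, e⟩]
end

section
/- Let G be an F_2-free split graph with split partition (K, I), and let s, t ∈ I have a common non-neighbour in K. If N(s) ⊄ N(t) and N(t) ⊄ N(s) (the neighbourhoods are incomparable), then |N(s) \ N(t)| = 1 and |N(t) \ N(s)| = 1. -/
variable {V : Type*}

instance F2.decidableRelAdj : DecidableRel F2.Adj := fun i j =>
  decidable_of_iff _ (SimpleGraph.fromRel_adj _ i j).symm

/-- In an `F₂`-free split graph, if `s, t ∈ I` have a common non-neighbour in `K` and `t` has a
neighbour that is not a neighbour of `s`, then at most one neighbour of `s` is not a neighbour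
of `t`. -/
theorem HFree.neighborSet_diff_subsingleton {G : SimpleGraph V} {K I : Set V}
    (h : IsSplitPartition G K I) (hfree : HFree G F2) {s t u : V} (hs : s ∈ I) (ht : t ∈ I)
    (hu : u ∈ K) (hsu : ¬ G.Adj s u) (htu : ¬ G.Adj t u)
    (hts : ¬ G.neighborSet t ⊆ G.neighborSet s) :
    (G.neighborSet s \ G.neighborSet t).Subsingleton := by
  obtain ⟨hcover, -, hclique, hindep⟩ := h
  obtain ⟨a, hta, hsa⟩ := Set.not_subset.mp hts
  rintro c ⟨hsc, htc⟩ d ⟨hsd, htd⟩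
  simp only [SimpleGraph.mem_neighborSet] at hta hsa hsc htc hsd htd
  by_contra hcd
  have mem_K {v w : V} (hv : v ∈ I) (hvw : G.Adj v w) : w ∈ K :=
    (hcover w).resolve_right fun hw => hindep v hv w hw hvw
  have ne_of_adj {v x y : V} (hx : G.Adj v x) (hy : ¬ G.Adj v y) : x ≠ y := by
    rintro rfl
    exact hy hx
  have hau : G.Adj a u := hclique a (mem_K ht hta) u hu (ne_of_adj hta htu)
  have hac : G.Adj a c := hclique a (mem_K ht hta) c (mem_K hs hsc) (ne_of_adj hta htc)
  have had : G.Adj a d := hclique a (mem_K ht hta) d (mem_K hs hsd) (ne_of_adj hta htd)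
  have huc : G.Adj u c := hclique u hu c (mem_K hs hsc) (ne_of_adj hsc hsu).symm
  have hud : G.Adj u d := hclique u hu d (mem_K hs hsd) (ne_of_adj hsd hsu).symm
  have hcd' : G.Adj c d := hclique c (mem_K hs hsc) d (mem_K hs hsd) hcd
  have hst : ¬ G.Adj s t := hindep s hs t ht
  have hadj (i j : Fin 6) :
      G.Adj (![a, u, c, d, t, s] i) (![a, u, c, d, t, s] j) ↔ F2.Adj i j := by
    fin_cases i <;> fin_cases j <;>
      simp [F2, SimpleGraph.fromRel_adj, hau, hac, had, huc, hud, hcd', hst, hta, hsa, hsc, htc,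
        hsd, htd, hsu, htu, hau.symm, hac.symm, had.symm, huc.symm, hud.symm, hcd'.symm,
        hta.symm, hsc.symm, hsd.symm, G.adj_comm _ s, G.adj_comm _ t]
  have separated : ∀ i j : Fin 6, i ≠ j → ∃ k, ¬ (F2.Adj i k ↔ F2.Adj j k) := by
    decide
  refine hfree.false ⟨⟨![a, u, c, d, t, s], fun i j hij => ?_⟩, fun {i j} => hadj i j⟩
  by_contra hne
  obtain ⟨k, hk⟩ := separated i j hne
  exact hk (by rw [← hadj, ← hadj, hij])

/-- Let `G` be an `F₂`-free split graph with split partition `(K, I)`, and let `s, t ∈ I`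
have a common non-neighbour in `K`. If the neighbourhoods of `s` and `t` are incomparable,
then `|N(s) \ N(t)| = 1` and `|N(t) \ N(s)| = 1`. -/
theorem F2_free_incomparable_neighbourhoods (G : SimpleGraph V) (K I : Set V)
    (h : IsSplitPartition G K I) (hfree : HFree G F2)
    (s t : V) (hs : s ∈ I) (ht : t ∈ I)
    (u : V) (hu : u ∈ K) (hsu : ¬ G.Adj s u) (htu : ¬ G.Adj t u)
    (hst : ¬ G.neighborSet s ⊆ G.neighborSet t)
    (hts : ¬ G.neighborSet t ⊆ G.neighborSet s) :
    (G.neighborSet s \ G.neighborSet t).encard = 1 ∧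
    (G.neighborSet t \ G.neighborSet s).encard = 1 := by
  obtain ⟨x, hx⟩ := Set.not_subset.mp hst
  obtain ⟨y, hy⟩ := Set.not_subset.mp hts
  refine ⟨Set.encard_eq_one.mpr ⟨x, ?_⟩, Set.encard_eq_one.mpr ⟨y, ?_⟩⟩
  · exact (hfree.neighborSet_diff_subsingleton h hs ht hu hsu htu hts).eq_singleton_of_mem hx
  · exact (hfree.neighborSet_diff_subsingleton h ht hs hu htu hsu hst).eq_singleton_of_mem hy
end

section
/- Let G be an F_2-free split graph with split partition (K, I), and suppose G contains an induced copy of Q with triangle {j1, j2, j3} ⊆ K and vertices i1, i2, i3 ∈ I, where i1 is adjacent (among j1, j2, j3) only to j1, i2 only to j2, and i3 exactly to j2 and j3. Then every vertex of K is adjacent to i1 or to i3, i.e., N(i1) ∪ N(i3) = K. -/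
variable {V : Type*}

instance : DecidableRel F2.Adj := fun u v =>
  decidable_of_iff _ (SimpleGraph.fromRel_adj _ u v).symm

/-- Six vertices with the adjacencies of `F2` span an induced copy of `F2`; they are
automatically distinct because no two vertices of `F2` have the same neighbourhood. -/
theorem nonempty_F2_embedding {G : SimpleGraph V} {a b c d e x : V}
    (hab : G.Adj a b) (hac : G.Adj a c) (had : G.Adj a d) (hbc : G.Adj b c) (hbd : G.Adj b d)
    (hcd : G.Adj c d) (hae : G.Adj a e) (hbe : ¬ G.Adj b e) (hce : ¬ G.Adj c e)
    (hde : ¬ G.Adj d e) (hax : ¬ G.Adj a x) (hbx : ¬ G.Adj b x) (hcx : G.Adj c x)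
    (hdx : G.Adj d x) (hex : ¬ G.Adj e x) : Nonempty (F2 ↪g G) := by
  have hadj : ∀ u v, G.Adj (![a, b, c, d, e, x] u) (![a, b, c, d, e, x] v) ↔ F2.Adj u v := by
    intro u v
    fin_cases u <;> fin_cases v <;>
      simp [F2, hab, hac, had, hbc, hbd, hcd, hae, hbe, hce, hde, hax, hbx, hcx, hdx, hex,
        hab.symm, hac.symm, had.symm, hbc.symm, hbd.symm, hcd.symm, hae.symm, hcx.symm, hdx.symm,
        mt G.adj_symm hbe, mt G.adj_symm hce, mt G.adj_symm hde,
        mt G.adj_symm hax, mt G.adj_symm hbx, mt G.adj_symm hex]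
  have hsep : ∀ u v, (∀ w, F2.Adj u w ↔ F2.Adj v w) → u = v := by decide
  refine ⟨⟨⟨![a, b, c, d, e, x], fun u v huv => hsep u v fun w => ?_⟩, hadj _ _⟩⟩
  rw [← hadj, ← hadj, huv]

/-- Let `G` be an `F₂`-free split graph with split partition `(K, I)` containing an induced
copy of `Q` (via an embedding `f`, with `j1,j2,j3 = 0,1,2` mapped into `K` and
`i1,i2,i3 = 3,4,5` mapped into `I`). Then every vertex of `K` is adjacent to `i1` or `i3`,
i.e. `N(i1) ∪ N(i3) = K`. -/
theorem F2_free_Q_neighbourhoods_cover_K (G : SimpleGraph V) (K I : Set V)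
    (h : IsSplitPartition G K I) (hfree : HFree G F2)
    (f : Qgraph ↪g G) (h0 : f 0 ∈ K) (h1 : f 1 ∈ K) (h2 : f 2 ∈ K)
    (h3 : f 3 ∈ I) (h4 : f 4 ∈ I) (h5 : f 5 ∈ I) :
    G.neighborSet (f 3) ∪ G.neighborSet (f 5) = K := by
  obtain ⟨hcover, -, hK, hI⟩ := h
  have hQ : ∀ u v, G.Adj (f u) (f v) ↔ Qgraph.Adj u v := fun _ _ => f.map_adj_iff
  ext v
  constructor
  · rintro (hv | hv)
    · exact (hcover v).resolve_right fun hvI => hI _ h3 _ hvI hv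
    · exact (hcover v).resolve_right fun hvI => hI _ h5 _ hvI hv
  · intro hv
    by_contra hnot
    simp only [Set.mem_union, SimpleGraph.mem_neighborSet, not_or] at hnot
    obtain ⟨hv3, hv5⟩ := hnot
    have hne0 : f 0 ≠ v := by
      rintro rfl
      exact hv3 ((hQ _ _).2 (by simp [Qgraph]))
    have hne1 : v ≠ f 1 := by
      rintro rfl
      exact hv5 ((hQ _ _).2 (by simp [Qgraph]))
    have hne2 : v ≠ f 2 := by
      rintro rfl
      exact hv5 ((hQ _ _).2 (by simp [Qgraph]))
    refine not_nonempty_iff.2 hfree (nonempty_F2_embedding (a := f 0) (b := v) (c := f 1)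
      (d := f 2) (e := f 3) (x := f 5) (hK _ h0 _ hv hne0) ?_ ?_ (hK _ hv _ h1 hne1)
      (hK _ hv _ h2 hne2) ?_ ?_ (fun h => hv3 h.symm) ?_ ?_ ?_ (fun h => hv5 h.symm) ?_ ?_ ?_) <;>
    · rw [hQ]
      simp [Qgraph]
end

section
/- Let G be an F_2-free split graph with split partition (K, I), and suppose G contains an induced copy of Q with triangle {j1, j2, j3} ⊆ K and vertices i1, i2, i3 ∈ I, where i1 is adjacent (among j1, j2, j3) only to j1, i2 only to j2, and i3 exactly to j2 and j3. Then N(i1) \ {j1} = N(i2) \ {j2}; equivalently, N(i1) = (N(i2) \ {j2}) ∪ {j1}. -/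
variable {V : Type*}

/-- A clique `a, b, c, d` together with nonadjacent `e`, `w`, where `e` sees only `a` and `w` sees
exactly `c` and `d`, is an induced copy of `F2`. -/
theorem not_hFree_F2_of_adj {G : SimpleGraph V} {a b c d e w : V}
    (hab : G.Adj a b) (hac : G.Adj a c) (had : G.Adj a d) (hbc : G.Adj b c) (hbd : G.Adj b d)
    (hcd : G.Adj c d) (hea : G.Adj e a) (heb : ¬ G.Adj e b) (hec : ¬ G.Adj e c)
    (hed : ¬ G.Adj e d) (hwa : ¬ G.Adj w a) (hwb : ¬ G.Adj w b) (hwc : G.Adj w c)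
    (hwd : G.Adj w d) (hew : ¬ G.Adj e w) : ¬ HFree G F2 := by
  have heb' : e ≠ b := by rintro rfl; exact hec hbc
  have hec' : e ≠ c := by rintro rfl; exact heb hbc.symm
  have hed' : e ≠ d := by rintro rfl; exact heb hbd.symm
  have hwa' : w ≠ a := by rintro rfl; exact hwb hab
  have hwb' : w ≠ b := by rintro rfl; exact hwa hab.symm
  have hew' : e ≠ w := by rintro rfl; exact hwa hea
  have hinj : Function.Injective ![a, b, c, d, e, w] := by
    intro x y hxy
    fin_cases x <;> fin_cases y <;>
      simp_all [hab.ne, hac.ne, had.ne, hbc.ne, hbd.ne, hcd.ne, hea.ne, hwc.ne, hwd.ne]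
  rw [HFree, not_isEmpty_iff]
  refine ⟨⟨⟨![a, b, c, d, e, w], hinj⟩, ?_⟩⟩
  intro x y
  have hnadj : ∀ {u v : V}, ¬ G.Adj u v → ¬ G.Adj v u := fun huv => mt SimpleGraph.Adj.symm huv
  fin_cases x <;> fin_cases y <;>
    simp [F2, hab, hac, had, hbc, hbd, hcd, hea, heb, hec, hed, hwa, hwb, hwc, hwd, hew,
      hab.symm, hac.symm, had.symm, hbc.symm, hbd.symm, hcd.symm, hea.symm, hnadj heb, hnadj hec,
      hnadj hed, hnadj hwa, hnadj hwb, hwc.symm, hwd.symm, hnadj hew]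

/-- In an `F2`-free split graph, let `i`, `i'` be independent vertices which see, among three
clique vertices `p`, `q`, `r`, only `p` and only `q` respectively. Then every neighbour of `i`
other than `p` is a neighbour of `i'` other than `q`. -/
theorem IsSplitPartition.neighborSet_diff_subset {G : SimpleGraph V} {K I : Set V}
    (h : IsSplitPartition G K I) (hfree : HFree G F2) {p q r i i' : V}
    (hp : p ∈ K) (hq : q ∈ K) (hr : r ∈ K) (hi : i ∈ I) (hi' : i' ∈ I)
    (hpq : p ≠ q) (hpr : p ≠ r) (hqr : q ≠ r)
    (hip : G.Adj i p) (hiq : ¬ G.Adj i q) (hir : ¬ G.Adj i r)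
    (hi'p : ¬ G.Adj i' p) (hi'q : G.Adj i' q) (hi'r : ¬ G.Adj i' r) :
    G.neighborSet i \ {p} ⊆ G.neighborSet i' \ {q} := by
  obtain ⟨hcover, -, hK, hI⟩ := h
  rintro x ⟨hix : G.Adj i x, hxp : x ≠ p⟩
  have hx : x ∈ K := (hcover x).resolve_right fun hx => hI i hi x hx hix
  have hxq : x ≠ q := by rintro rfl; exact hiq hix
  have hxr : x ≠ r := by rintro rfl; exact hir hix
  refine ⟨?_, hxq⟩
  by_contra hi'x
  exact not_hFree_F2_of_adj (hK q hq r hr hqr) (hK q hq p hp hpq.symm) (hK q hq x hx hxq.symm)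
    (hK r hr p hp hpr.symm) (hK r hr x hx hxr.symm) (hK p hp x hx hxp.symm)
    hi'q hi'r hi'p hi'x hiq hir hip hix (hI i' hi' i hi) hfree

/-- Let `G` be an `F₂`-free split graph with split partition `(K, I)` containing an induced
copy of `Q` (via an embedding `f`, with `j1,j2,j3 = 0,1,2` mapped into `K` and
`i1,i2,i3 = 3,4,5` mapped into `I`). Then `N(i1) \ {j1} = N(i2) \ {j2}`; equivalently,
`N(i1) = (N(i2) \ {j2}) ∪ {j1}`. -/
theorem F2_free_Q_similar_neighbourhoods (G : SimpleGraph V) (K I : Set V)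
    (h : IsSplitPartition G K I) (hfree : HFree G F2)
    (f : Qgraph ↪g G) (h0 : f 0 ∈ K) (h1 : f 1 ∈ K) (h2 : f 2 ∈ K)
    (h3 : f 3 ∈ I) (h4 : f 4 ∈ I) (h5 : f 5 ∈ I) :
    G.neighborSet (f 3) \ {f 0} = G.neighborSet (f 4) \ {f 1} ∧
    G.neighborSet (f 3) = (G.neighborSet (f 4) \ {f 1}) ∪ {f 0} := by
  have a30 : G.Adj (f 3) (f 0) := f.map_adj_iff.2 (by simp [Qgraph])
  have a31 : ¬ G.Adj (f 3) (f 1) := mt f.map_adj_iff.1 (by simp [Qgraph])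
  have a32 : ¬ G.Adj (f 3) (f 2) := mt f.map_adj_iff.1 (by simp [Qgraph])
  have a40 : ¬ G.Adj (f 4) (f 0) := mt f.map_adj_iff.1 (by simp [Qgraph])
  have a41 : G.Adj (f 4) (f 1) := f.map_adj_iff.2 (by simp [Qgraph])
  have a42 : ¬ G.Adj (f 4) (f 2) := mt f.map_adj_iff.1 (by simp [Qgraph])
  have n01 : f 0 ≠ f 1 := f.injective.ne (by decide)
  have n02 : f 0 ≠ f 2 := f.injective.ne (by decide)
  have n12 : f 1 ≠ f 2 := f.injective.ne (by decide)
  have heq : G.neighborSet (f 3) \ {f 0} = G.neighborSet (f 4) \ {f 1} :=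
    (h.neighborSet_diff_subset hfree h0 h1 h2 h3 h4 n01 n02 n12 a30 a31 a32 a40 a41 a42).antisymm
      (h.neighborSet_diff_subset hfree h1 h0 h2 h4 h3 n01.symm n12 n02 a41 a40 a42 a31 a30 a32)
  refine ⟨heq, ?_⟩
  have hsub : {f 0} ⊆ G.neighborSet (f 3) := Set.singleton_subset_iff.2 a30
  rw [← heq, Set.sdiff_union_of_subset hsub]
end

section
/- No F_2-free split graph contains two vertex-disjoint induced copies of Q. -/
variable {V : Type*}

/-- Six vertices with the adjacencies of `F₂` cannot occur in an `F₂`-free graph. -/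
lemma HFree.false_of_F2_adj {G : SimpleGraph V} (hfree : HFree G F2) {a b c d e f : V}
    (hab : G.Adj a b) (hac : G.Adj a c) (had : G.Adj a d) (hbc : G.Adj b c) (hbd : G.Adj b d)
    (hcd : G.Adj c d) (hea : G.Adj e a) (hfc : G.Adj f c) (hfd : G.Adj f d)
    (heb : ¬ G.Adj e b) (hec : ¬ G.Adj e c) (hed : ¬ G.Adj e d)
    (hfa : ¬ G.Adj f a) (hfb : ¬ G.Adj f b) (hef : ¬ G.Adj e f) : False := by
  have hadj : ∀ u v : Fin 6,
      G.Adj (![a, b, c, d, e, f] u) (![a, b, c, d, e, f] v) ↔ F2.Adj u v := by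
    intro u v
    fin_cases u <;> fin_cases v <;> simp [F2] <;> first | assumption | (rw [G.adj_comm]; assumption)
  have hinj : Function.Injective ![a, b, c, d, e, f] := by
    have hsep : ∀ u v : Fin 6, (∀ w, F2.Adj u w ↔ F2.Adj v w) → u = v := by
      let _ : DecidableRel F2.Adj := fun u v => by
        unfold F2
        simp only [SimpleGraph.fromRel_adj]
        infer_instance
      decide
    intro u v huv
    refine hsep u v fun w => ?_
    rw [← hadj, ← hadj, huv]
  exact hfree.false ⟨⟨_, hinj⟩, hadj _ _⟩

namespace IsSplitPartition

variable {G : SimpleGraph V} {K I : Set V}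

/-- Four clique vertices and two independent vertices do not form an `F₂`. -/
lemma false_of_two_independent (h : IsSplitPartition G K I) (hfree : HFree G F2)
    {a b c d e f : V} (ha : a ∈ K) (hb : b ∈ K) (hc : c ∈ K) (hd : d ∈ K)
    (he : e ∈ I) (hf : f ∈ I) (hab : a ≠ b) (hcd : c ≠ d)
    (hea : G.Adj e a) (heb : ¬ G.Adj e b) (hec : ¬ G.Adj e c) (hed : ¬ G.Adj e d)
    (hfa : ¬ G.Adj f a) (hfb : ¬ G.Adj f b) (hfc : G.Adj f c) (hfd : G.Adj f d) : False := by
  have hK := h.2.2.1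
  exact hfree.false_of_F2_adj (hK a ha b hb hab) (hK a ha c hc (by rintro rfl; exact hec hea))
    (hK a ha d hd (by rintro rfl; exact hed hea)) (hK b hb c hc (by rintro rfl; exact hfb hfc))
    (hK b hb d hd (by rintro rfl; exact hfb hfd)) (hK c hc d hd hcd)
    hea hfc hfd heb hec hed hfa hfb (h.2.2.2 e he f hf)

/-- Three clique vertices and three independent vertices do not form an `F₂`. -/
lemma false_of_three_independent (h : IsSplitPartition G K I) (hfree : HFree G F2)
    {a b c d e f : V} (ha : a ∈ K) (hb : b ∈ I) (hc : c ∈ K) (hd : d ∈ K)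
    (he : e ∈ I) (hf : f ∈ I) (hcd : c ≠ d)
    (hba : G.Adj b a) (hbc : G.Adj b c) (hbd : G.Adj b d)
    (hea : G.Adj e a) (hec : ¬ G.Adj e c) (hed : ¬ G.Adj e d)
    (hfa : ¬ G.Adj f a) (hfc : G.Adj f c) (hfd : G.Adj f d) : False := by
  have hK := h.2.2.1
  have hI := h.2.2.2
  exact hfree.false_of_F2_adj hba.symm (hK a ha c hc (by rintro rfl; exact hec hea))
    (hK a ha d hd (by rintro rfl; exact hed hea)) hbc hbd (hK c hc d hd hcd)
    hea hfc hfd (hI e he b hb) hec hed hfa (hI f hf b hb) (hI e he f hf)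

/-- Two distinct nonadjacent vertices with a common neighbour keep that neighbour in `K`. -/
lemma mem_clique_of_adj (h : IsSplitPartition G K I) {u v w : V} (huv : G.Adj u v)
    (huw : G.Adj u w) (hne : v ≠ w) (hvw : ¬ G.Adj v w) : u ∈ K := by
  refine (h.1 u).resolve_right fun hu => hvw ?_
  exact h.2.2.1 v ((h.1 v).resolve_right fun hv => h.2.2.2 u hu v hv huv)
    w ((h.1 w).resolve_right fun hw => h.2.2.2 u hu w hw huw) hne

/-- A vertex that is distinct from and not adjacent to some vertex of `K` lies in `I`. -/
lemma mem_independent_of_not_adj (h : IsSplitPartition G K I) {u v : V} (hv : v ∈ K)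
    (hne : u ≠ v) (huv : ¬ G.Adj u v) : u ∈ I :=
  (h.1 u).resolve_left fun hu => huv (h.2.2.1 u hu v hv hne)

end IsSplitPartition

/-- The vertices `j1, j2, j3 ∈ K` and `i1, i2, i3 ∈ I` induce a copy of `Q`. -/
structure IsQ (G : SimpleGraph V) (K I : Set V) (j1 j2 j3 i1 i2 i3 : V) : Prop where
  hj1 : j1 ∈ K
  hj2 : j2 ∈ K
  hj3 : j3 ∈ K
  hi1 : i1 ∈ I
  hi2 : i2 ∈ I
  hi3 : i3 ∈ I
  ne12 : j1 ≠ j2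
  ne13 : j1 ≠ j3
  ne23 : j2 ≠ j3
  adj11 : G.Adj i1 j1
  not_adj12 : ¬ G.Adj i1 j2
  not_adj13 : ¬ G.Adj i1 j3
  not_adj21 : ¬ G.Adj i2 j1
  adj22 : G.Adj i2 j2
  not_adj23 : ¬ G.Adj i2 j3
  not_adj31 : ¬ G.Adj i3 j1
  adj32 : G.Adj i3 j2
  adj33 : G.Adj i3 j3

/-- An induced copy of `Q` in a split graph has its triangle in the clique and the remaining
vertices in the independent set. -/
lemma IsSplitPartition.isQ {G : SimpleGraph V} {K I : Set V} (h : IsSplitPartition G K I)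
    (f : Qgraph ↪g G) : IsQ G K I (f 0) (f 1) (f 2) (f 3) (f 4) (f 5) := by
  have hadj : ∀ u v, G.Adj (f u) (f v) ↔ Qgraph.Adj u v := fun u v => f.map_adj_iff
  have hne : ∀ u v, f u ≠ f v ↔ u ≠ v := fun u v => f.injective.ne_iff
  simp only [Qgraph, SimpleGraph.fromRel_adj] at hadj
  have h0 : f 0 ∈ K := h.mem_clique_of_adj (v := f 1) (w := f 3)
    ((hadj _ _).2 (by decide)) ((hadj _ _).2 (by decide)) ((hne _ _).2 (by decide))
    (mt (hadj _ _).1 (by decide))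
  have h1 : f 1 ∈ K := h.mem_clique_of_adj (v := f 0) (w := f 4)
    ((hadj _ _).2 (by decide)) ((hadj _ _).2 (by decide)) ((hne _ _).2 (by decide))
    (mt (hadj _ _).1 (by decide))
  have h2 : f 2 ∈ K := h.mem_clique_of_adj (v := f 0) (w := f 5)
    ((hadj _ _).2 (by decide)) ((hadj _ _).2 (by decide)) ((hne _ _).2 (by decide))
    (mt (hadj _ _).1 (by decide))
  refine ⟨h0, h1, h2,
    h.mem_independent_of_not_adj h1 ((hne _ _).2 (by decide)) (mt (hadj _ _).1 (by decide)),
    h.mem_independent_of_not_adj h0 ((hne _ _).2 (by decide)) (mt (hadj _ _).1 (by decide)),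
    h.mem_independent_of_not_adj h0 ((hne _ _).2 (by decide)) (mt (hadj _ _).1 (by decide)),
    ?_, ?_, ?_, ?_, ?_, ?_, ?_, ?_, ?_, ?_, ?_, ?_⟩ <;>
    first
    | exact (hne _ _).2 (by decide)
    | exact (hadj _ _).2 (by decide)
    | exact mt (hadj _ _).1 (by decide)

namespace IsQ

variable {G : SimpleGraph V} {K I : Set V} {j1 j2 j3 i1 i2 i3 : V}

lemma adj_i1_iff_adj_i2 (q : IsQ G K I j1 j2 j3 i1 i2 i3) (h : IsSplitPartition G K I)
    (hfree : HFree G F2) {x : V} (hx : x ∈ K) (hx1 : j1 ≠ x) (hx2 : j2 ≠ x) :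
    G.Adj i1 x ↔ G.Adj i2 x := by
  constructor
  · intro h1
    by_contra h2
    exact h.false_of_two_independent hfree q.hj2 q.hj3 q.hj1 hx q.hi2 q.hi1 q.ne23 hx1
      q.adj22 q.not_adj23 q.not_adj21 h2 q.not_adj12 q.not_adj13 q.adj11 h1
  · intro h2
    by_contra h1
    exact h.false_of_two_independent hfree q.hj1 q.hj3 q.hj2 hx q.hi1 q.hi2 q.ne13 hx2
      q.adj11 q.not_adj13 q.not_adj12 h1 q.not_adj21 q.not_adj23 q.adj22 h2

lemma adj_i1_or_adj_i3 (q : IsQ G K I j1 j2 j3 i1 i2 i3) (h : IsSplitPartition G K I)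
    (hfree : HFree G F2) {x : V} (hx : x ∈ K) (hx1 : j1 ≠ x) : G.Adj i1 x ∨ G.Adj i3 x := by
  by_contra! hn
  exact h.false_of_two_independent hfree q.hj1 hx q.hj2 q.hj3 q.hi1 q.hi3 hx1 q.ne23
    q.adj11 hn.1 q.not_adj12 q.not_adj13 q.not_adj31 hn.2 q.adj32 q.adj33

/-- If `i3` misses some further clique vertex, then `i1` and `i2` are adjacent to every further
clique vertex. -/
lemma adj_of_not_adj_i3 (q : IsQ G K I j1 j2 j3 i1 i2 i3) (h : IsSplitPartition G K I)
    (hfree : HFree G F2) {x y : V} (hx : x ∈ K) (hx1 : j1 ≠ x) (hx2 : j2 ≠ x)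
    (hn : ¬ G.Adj i3 x) (hy : y ∈ K) (hy1 : j1 ≠ y) (hy2 : j2 ≠ y) (hy3 : j3 ≠ y) :
    G.Adj i1 y ∧ G.Adj i2 y := by
  have hiff := q.adj_i1_iff_adj_i2 h hfree hy hy1 hy2
  have h2x := (q.adj_i1_iff_adj_i2 h hfree hx hx1 hx2).1
    ((q.adj_i1_or_adj_i3 h hfree hx hx1).resolve_right hn)
  suffices h2y : G.Adj i2 y from ⟨hiff.2 h2y, h2y⟩
  by_contra h2y
  have h3y := (q.adj_i1_or_adj_i3 h hfree hy hy1).resolve_left (mt hiff.1 h2y)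
  exact h.false_of_two_independent hfree hx q.hj1 q.hj3 hy q.hi2 q.hi3 hx1.symm hy3
    h2x q.not_adj21 q.not_adj23 h2y hn q.not_adj31 q.adj33 h3y

/-- No vertex of `I` is adjacent to all three of `j1, j2, j3`. -/
lemma not_adj_triangle (q : IsQ G K I j1 j2 j3 i1 i2 i3) (h : IsSplitPartition G K I)
    (hfree : HFree G F2) {b : V} (hb : b ∈ I) :
    ¬ (G.Adj b j1 ∧ G.Adj b j2 ∧ G.Adj b j3) := fun hadj =>
  h.false_of_three_independent hfree q.hj1 hb q.hj2 q.hj3 q.hi1 q.hi3 q.ne23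
    hadj.1 hadj.2.1 hadj.2.2 q.adj11 q.not_adj12 q.not_adj13 q.not_adj31 q.adj32 q.adj33

/-- If the triangle of a second copy of `Q` avoids that of the first, then the vertices `i1`, `i2`
of the first copy are adjacent to the whole second triangle. -/
lemma adj_of_disjoint (q : IsQ G K I j1 j2 j3 i1 i2 i3) {k1 k2 k3 l1 l2 l3 : V}
    (r : IsQ G K I k1 k2 k3 l1 l2 l3) (h : IsSplitPartition G K I) (hfree : HFree G F2)
    (hne : ∀ y, y = k1 ∨ y = k2 ∨ y = k3 → j1 ≠ y ∧ j2 ≠ y ∧ j3 ≠ y)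
    {y : V} (hy : y = k1 ∨ y = k2 ∨ y = k3) : G.Adj i1 y ∧ G.Adj i2 y := by
  have hK : ∀ z, z = k1 ∨ z = k2 ∨ z = k3 → z ∈ K := by
    rintro z (rfl | rfl | rfl)
    exacts [r.hj1, r.hj2, r.hj3]
  obtain ⟨x, hx, hn⟩ : ∃ x, (x = k1 ∨ x = k2 ∨ x = k3) ∧ ¬ G.Adj i3 x := by
    by_contra! hall
    exact r.not_adj_triangle h hfree q.hi3
      ⟨hall _ (.inl rfl), hall _ (.inr (.inl rfl)), hall _ (.inr (.inr rfl))⟩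
  exact q.adj_of_not_adj_i3 h hfree (hK x hx) (hne x hx).1 (hne x hx).2.1 hn (hK y hy)
    (hne y hy).1 (hne y hy).2.1 (hne y hy).2.2

end IsQ

/-- No `F₂`-free split graph contains two vertex-disjoint induced copies of `Q`. -/
theorem F2_free_no_two_disjoint_Q (G : SimpleGraph V) (K I : Set V)
    (h : IsSplitPartition G K I) (hfree : HFree G F2) :
    ¬ ∃ f g : Qgraph ↪g G, Disjoint (Set.range f) (Set.range g) := by
  rintro ⟨f, g, hfg⟩
  have hne : ∀ u v, f u ≠ g v := fun u v =>
    hfg.ne_of_mem (Set.mem_range_self u) (Set.mem_range_self v)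
  have q := h.isQ f
  have r := h.isQ g
  have hq := fun y => q.adj_of_disjoint (y := y) r h hfree (by
    rintro y (rfl | rfl | rfl) <;> exact ⟨hne _ _, hne _ _, hne _ _⟩)
  have hr := fun y => r.adj_of_disjoint (y := y) q h hfree (by
    rintro y (rfl | rfl | rfl) <;> exact ⟨(hne _ _).symm, (hne _ _).symm, (hne _ _).symm⟩)
  have hr1 := hr (f 1) (.inr (.inl rfl))
  have hr2 := hr (f 2) (.inr (.inr rfl))
  exact h.false_of_three_independent hfree r.hj1 r.hi1 q.hj2 q.hj3 q.hi1 r.hi2 q.ne23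
    r.adj11 hr1.1 hr2.1 (hq (g 0) (.inl rfl)).1 q.not_adj12 q.not_adj13
    r.not_adj21 hr1.2 hr2.2
end

section
/- Let G be a (K_{1,3}+2P_1)-free split graph with split partition (K, I). Then every vertex v ∈ K has at most two neighbours in I or at most one non-neighbour in I, i.e., |N(v) ∩ I| ≤ 2 or |I \ N(v)| ≤ 1. -/
variable {V : Type*}

/-- Let `G` be a `(K_{1,3} + 2P₁)`-free split graph with split partition `(K, I)`. Then every
vertex `v ∈ K` has at most two neighbours in `I` or at most one non-neighbour in `I`. -/
theorem K13_2P1_free_clique_vertex_degrees (G : SimpleGraph V) (K I : Set V)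
    (h : IsSplitPartition G K I) (hfree : HFree G K13_2P1) :
    ∀ v ∈ K, (G.neighborSet v ∩ I).encard ≤ 2 ∨ (I \ G.neighborSet v).encard ≤ 1 := by
  obtain ⟨-, hdisj, -, hI⟩ := h
  intro v hv
  by_contra! hcon
  obtain ⟨hN, hM⟩ := hcon
  have h3 : (3 : ℕ∞) ≤ (G.neighborSet v ∩ I).encard := Order.add_one_le_of_lt hN
  obtain ⟨t, ht, htcard⟩ := Set.exists_subset_encard_eq h3
  obtain ⟨a, b, c, hab, hac, hbc, rfl⟩ := Set.encard_eq_three.mp htcard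
  obtain ⟨d, e, ⟨hdI, hvd⟩, ⟨heI, hve⟩, hde⟩ := Set.one_lt_encard_iff.mp hM
  obtain ⟨hva, haI⟩ := ht (show a ∈ ({a, b, c} : Set V) by simp)
  obtain ⟨hvb, hbI⟩ := ht (show b ∈ ({a, b, c} : Set V) by simp)
  obtain ⟨hvc, hcI⟩ := ht (show c ∈ ({a, b, c} : Set V) by simp)
  have hvI : v ∉ I := Set.disjoint_left.mp hdisj hv
  simp only [SimpleGraph.mem_neighborSet] at hva hvb hvc hvd hve
  refine hfree.false ⟨⟨![v, a, b, c, d, e], ?_⟩, ?_⟩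
  · have hne {x y : V} (hx : G.Adj v x) (hy : ¬ G.Adj v y) : x ≠ y := by
      rintro rfl
      exact hy hx
    have hvne {x : V} (hx : x ∈ I) : v ≠ x := fun h => hvI (h ▸ hx)
    simp [Matrix.vecCons, Fin.cons_injective_iff, Matrix.vecEmpty, hvne haI, hvne hbI,
      hvne hcI, hvne hdI, hvne heI, hne hva hvd, hne hva hve, hne hvb hvd, hne hvb hve,
      hne hvc hvd, hne hvc hve, hab, hac, hbc, hde, Function.injective_of_subsingleton]
  · intro i j
    change G.Adj (![v, a, b, c, d, e] i) (![v, a, b, c, d, e] j) ↔ _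
    revert i j
    simp [Fin.forall_fin_succ, K13_2P1, hva, hvb, hvc, hvd, hve, hva.symm, hvb.symm, hvc.symm,
      G.adj_comm d v, G.adj_comm e v, hI, haI, hbI, hcI, hdI, heI]
end

section
/- Let G be a (K_{1,3}+2P_1)-free split graph with split partition (K, I) where |I| ≥ 6. If x, y ∈ K are distinct vertices each having exactly two neighbours in I, then x and y have a common neighbour in I. -/
variable {V : Type*}

/-- Let `G` be a `(K_{1,3} + 2P₁)`-free split graph with split partition `(K, I)` where
`|I| ≥ 6`. If `x, y ∈ K` are distinct vertices each having exactly two neighbours in `I`,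
then `x` and `y` have a common neighbour in `I`. -/
theorem K13_2P1_free_common_neighbour (G : SimpleGraph V) (K I : Set V)
    (h : IsSplitPartition G K I) (hfree : HFree G K13_2P1) (hI : 6 ≤ I.encard)
    (x y : V) (hx : x ∈ K) (hy : y ∈ K) (hxy : x ≠ y)
    (hx2 : (G.neighborSet x ∩ I).encard = 2) (hy2 : (G.neighborSet y ∩ I).encard = 2) :
    ∃ w ∈ I, G.Adj x w ∧ G.Adj y w := by
  by_contra! hno
  obtain ⟨-, hdis, hK, hind⟩ := h
  obtain ⟨a, b, hab, hNx⟩ := Set.encard_eq_two.1 hx2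
  have ha : G.Adj x a ∧ a ∈ I := by
    have : a ∈ G.neighborSet x ∩ I := by simp [hNx]
    exact this
  have hb : G.Adj x b ∧ b ∈ I := by
    have : b ∈ G.neighborSet x ∩ I := by simp [hNx]
    exact this
  have hcover : I ⊆ (I \ (G.neighborSet x ∪ G.neighborSet y)) ∪
      ((G.neighborSet x ∩ I) ∪ (G.neighborSet y ∩ I)) := by
    intro v hv
    simp only [Set.mem_union, Set.mem_sdiff, Set.mem_inter_iff]
    tauto
  have hrest : 1 < (I \ (G.neighborSet x ∪ G.neighborSet y)).encard := by
    by_contra! hle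
    have hcard : I.encard ≤ 1 + (2 + 2) :=
      (Set.encard_le_encard hcover).trans <| (Set.encard_union_le _ _).trans <|
        add_le_add hle <| (Set.encard_union_le _ _).trans (add_le_add hx2.le hy2.le)
    exact absurd (hI.trans hcard) (by norm_num)
  obtain ⟨e, f, ⟨heI, he⟩, ⟨hfI, hf⟩, hef⟩ := Set.one_lt_encard_iff.1 hrest
  simp only [Set.mem_union, SimpleGraph.mem_neighborSet, not_or] at he hf
  have hya := hno a ha.2 ha.1
  have hyb := hno b hb.2 hb.1
  have hadj := hK x hx y hy hxy
  have hne : ∀ u ∈ K, ∀ v ∈ I, u ≠ v := fun u hu v hv huv =>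
    Set.disjoint_left.1 hdis hu (huv ▸ hv)
  have hinj : Function.Injective ![x, a, b, y, e, f] := by
    intro i j hij
    fin_cases i <;> fin_cases j <;> simp at hij ⊢ <;> grind
  refine hfree.false ⟨⟨_, hinj⟩, ?_⟩
  intro i j
  fin_cases i <;> fin_cases j <;> simp [K13_2P1] <;> grind [SimpleGraph.adj_comm]
end
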